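/- (Upper bound for the level set.) Assume b > 2χμ and let u0 satisfy (1.2) and (1.10). Let (u,v) be the classical solution of the chemotaxis system with u(·,0) = u0. For any ε > 0 and γ1 > 0, suppose ζ : (0,∞) → ℝ satisfies u0(ζ(t)) = γ1 e^{−(a+ε)t} for all sufficiently large t. Then for any ω ∈ (0, a/b) there is a constant T₁ ≥ 0 such that E_ω(t) ⊆ (−∞, ζ(t)] for all t ≥ T₁, where E_ω(t) = {x ∈ ℝ : u(x,t) = ω}. -/

import Mathlib

/-- Conditions (1.2) and (1.10) on the initial function `u0`, with `u0'`, `u0''` its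
first and second derivatives on `[ξ0, ∞)`. -/
def SlowlyDecayingInit (u0 u0' u0'' : ℝ → ℝ) (ξ0 : ℝ) : Prop :=
  Continuous u0 ∧ (∀ x, 0 < u0 x) ∧
    0 < Filter.liminf u0 Filter.atBot ∧
    Filter.Tendsto u0 Filter.atTop (nhds 0) ∧
    (∀ x, ξ0 ≤ x → HasDerivAt u0 (u0' x) x) ∧
    (∀ x, ξ0 ≤ x → HasDerivAt u0' (u0'' x) x) ∧
    ContinuousOn u0'' (Set.Ici ξ0) ∧
    (∀ x, ξ0 ≤ x → u0' x ≤ 0) ∧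
    Filter.Tendsto (fun x => u0'' x / u0 x) Filter.atTop (nhds 0)

/-- A classical solution `(u, v)` of the parabolic-elliptic chemotaxis system
`u_t = u_xx - χ (u v_x)_x + u (a - b u)`, `0 = v_xx - λ v + μ u` on `ℝ × (0, ∞)`,
with initial datum `u0`.  Here `ux, uxx, ut, vx, vxx` denote the corresponding
partial derivatives. -/
def IsClassicalSolution (χ a b lam mu : ℝ) (u0 : ℝ → ℝ)
    (u ux uxx ut v vx vxx : ℝ → ℝ → ℝ) : Prop :=
  (∀ x, u x 0 = u0 x) ∧
  (∀ x t, 0 ≤ t → 0 ≤ u x t) ∧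
  (∀ x t, 0 ≤ t → 0 ≤ v x t) ∧
  ContinuousOn (fun p : ℝ × ℝ => u p.1 p.2) ((Set.univ : Set ℝ) ×ˢ Set.Ici (0 : ℝ)) ∧
  (∃ L : ℝ, ∀ x t, 0 ≤ t → u x t ≤ L) ∧
  (∀ x t, 0 < t → HasDerivAt (fun y => u y t) (ux x t) x) ∧
  (∀ x t, 0 < t → HasDerivAt (fun y => ux y t) (uxx x t) x) ∧
  (∀ x t, 0 < t → HasDerivAt (fun s => u x s) (ut x t) t) ∧
  (∀ x t, 0 < t → HasDerivAt (fun y => v y t) (vx x t) x) ∧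
  (∀ x t, 0 < t → HasDerivAt (fun y => vx y t) (vxx x t) x) ∧
  (∀ x t, 0 < t →
      ut x t = uxx x t - χ * (ux x t * vx x t + u x t * vxx x t)
        + u x t * (a - b * u x t)) ∧
  (∀ x t, 0 < t → 0 = vxx x t - lam * v x t + mu * u x t)

lemma aux_tder (f : ℝ → ℝ) (d t : ℝ) (ht : 0 < t) (hf : HasDerivAt f d t)
    (hm : ∀ s, 0 ≤ s → s ≤ t → f s ≤ f t) : 0 ≤ d := by
  by_contra hd
  push Not at hd
  have h1 := (hasDerivAt_iff_tendsto_slope.1 hf).eventually (gt_mem_nhds hd)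
  have h2 : ∀ᶠ s in nhdsWithin t (Set.Iio t), slope f t s < 0 :=
    h1.filter_mono (nhdsWithin_mono _ (fun s hs => ne_of_lt hs))
  have h3 : ∀ᶠ s in nhdsWithin t (Set.Iio t), s ∈ Set.Ioo 0 t := Ioo_mem_nhdsLT ht
  obtain ⟨s, hs, hs1, hs2⟩ := (h2.and h3).exists
  rw [slope_def_field] at hs
  have := hm s hs1.le hs2.le
  have h4 : 0 ≤ (f s - f t) / (s - t) := div_nonneg_of_nonpos (by linarith) (by linarith)
  linarith

lemma aux_xder (f f' : ℝ → ℝ) (c x lo hi : ℝ) (h1 : lo < x) (h2 : x < hi)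
    (hf : ∀ y, lo ≤ y → HasDerivAt f (f' y) y) (hf' : HasDerivAt f' c x)
    (hm : ∀ y, lo ≤ y → y ≤ hi → f y ≤ f x) : f' x = 0 ∧ c ≤ 0 := by
  have hloc : IsLocalMax f x := by
    filter_upwards [Icc_mem_nhds h1 h2] with y hy
    exact hm y hy.1 hy.2
  have h0 := hloc.hasDerivAt_eq_zero (hf x h1.le)
  refine ⟨h0, ?_⟩
  by_contra hc
  push Not at hc
  have e1 := (hasDerivAt_iff_tendsto_slope.1 hf').eventually (lt_mem_nhds hc)
  have e2 : ∀ᶠ s in nhdsWithin x (Set.Ioi x), 0 < slope f' x s :=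
    e1.filter_mono (nhdsWithin_mono _ (fun s hs => ne_of_gt hs))
  obtain ⟨r, hr, hr2⟩ := (mem_nhdsGT_iff_exists_Ioo_subset).1 e2
  have hr : x < r := hr
  obtain ⟨y, hy1, hy2⟩ := exists_between (lt_min hr h2)
  obtain ⟨z, hz, hzz⟩ := exists_hasDerivAt_eq_slope f f' hy1
    (fun w hw => (hf w (by linarith [hw.1])).continuousAt.continuousWithinAt)
    (fun w hw => hf w (by linarith [hw.1]))
  have hz1 : 0 < slope f' x z := hr2 ⟨hz.1, hz.2.trans (hy2.trans_le (min_le_left _ _))⟩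
  rw [slope_def_field, h0, sub_zero] at hz1
  have hz2 : 0 < f' z := by
    have hzx : 0 < z - x := by linarith [hz.1]
    have := mul_pos hz1 hzx
    rwa [div_mul_cancel₀ _ hzx.ne'] at this
  have := hm y (by linarith) (hy2.le.trans (min_le_right _ _))
  have h4 : (f y - f x) / (y - x) ≤ 0 := div_nonpos_of_nonpos_of_nonneg (by linarith) (by linarith)
  linarith

/-- If `f ≥ 0` and `f'' ≤ k² f` on a right half line then `f' ≥ -k f` there. -/
lemma aux_log (f f' f'' : ℝ → ℝ) (k x0 : ℝ) (hk : 0 < k)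
    (hpos : ∀ x, x0 ≤ x → 0 ≤ f x)
    (hf : ∀ x, x0 ≤ x → HasDerivAt f (f' x) x)
    (hf' : ∀ x, x0 ≤ x → HasDerivAt f' (f'' x) x)
    (hle : ∀ x, x0 ≤ x → f'' x ≤ k ^ 2 * f x) : 0 ≤ f' x0 + k * f x0 := by
  by_contra hneg
  push Not at hneg
  have hE : ∀ (c x : ℝ), HasDerivAt (fun y => Real.exp (c * (y - x0)))
      (Real.exp (c * (x - x0)) * c) x := by
    intro c x
    have := (((hasDerivAt_id x).sub_const x0).const_mul c).exp
    simpa using this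
  set q0 := f' x0 + k * f x0 with hq0
  -- step 1
  have s1 : ∀ x, x0 ≤ x → Real.exp (-k * (x - x0)) * (f' x + k * f x) ≤ q0 := by
    have hanti : AntitoneOn (fun x => Real.exp (-k * (x - x0)) * (f' x + k * f x))
        (Set.Ici x0) := by
      have hd : ∀ x, x0 ≤ x → HasDerivAt
          (fun x => Real.exp (-k * (x - x0)) * (f' x + k * f x))
          (Real.exp (-k * (x - x0)) * (-k) * (f' x + k * f x)
            + Real.exp (-k * (x - x0)) * (f'' x + k * f' x)) x := fun x hx =>
        (hE (-k) x).mul ((hf' x hx).add ((hf x hx).const_mul k))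
      apply antitoneOn_of_hasDerivWithinAt_nonpos (convex_Ici x0)
        (fun x hx => (hd x hx).continuousAt.continuousWithinAt)
        (fun x hx => (hd x (interior_subset hx)).hasDerivWithinAt)
      intro x hx
      have hx : x0 ≤ x := interior_subset hx
      have h := hle x hx
      have : Real.exp (-k * (x - x0)) * (-k) * (f' x + k * f x)
            + Real.exp (-k * (x - x0)) * (f'' x + k * f' x)
          = Real.exp (-k * (x - x0)) * (f'' x - k ^ 2 * f x) := by ring
      rw [this]
      exact mul_nonpos_of_nonneg_of_nonpos (Real.exp_pos _).le (by linarith)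
    intro x hx
    have := hanti (Set.self_mem_Ici) hx hx
    simpa [hq0] using this
  -- step 2: e^{k(x-x0)} f + c (x - x0) is antitone
  have hanti : AntitoneOn (fun x => Real.exp (k * (x - x0)) * f x - q0 * (x - x0))
      (Set.Ici x0) := by
    have hd : ∀ x, x0 ≤ x → HasDerivAt
        (fun x => Real.exp (k * (x - x0)) * f x - q0 * (x - x0))
        (Real.exp (k * (x - x0)) * k * f x + Real.exp (k * (x - x0)) * f' x - q0 * 1) x :=
      fun x hx => ((hE k x).mul (hf x hx)).sub
        (((hasDerivAt_id x).sub_const x0).const_mul q0)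
    apply antitoneOn_of_hasDerivWithinAt_nonpos (convex_Ici x0)
      (fun x hx => (hd x hx).continuousAt.continuousWithinAt)
      (fun x hx => (hd x (interior_subset hx)).hasDerivWithinAt)
    intro x hx
    have hx : x0 ≤ x := interior_subset hx
    have h := s1 x hx
    have hm : Real.exp (-k * (x - x0)) * Real.exp (k * (x - x0)) = 1 := by
      rw [← Real.exp_add]; simp
    have hge : 1 ≤ Real.exp (k * (x - x0)) :=
      Real.one_le_exp (mul_nonneg hk.le (by linarith))
    set A := Real.exp (-k * (x - x0))
    set B := Real.exp (k * (x - x0))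
    have hA : 0 < A := Real.exp_pos _
    have hS : f' x + k * f x ≤ q0 * B := by
      have : f' x + k * f x = A * (f' x + k * f x) * B := by
        linear_combination (-(f' x + k * f x)) * hm
      rw [this]
      exact mul_le_mul_of_nonneg_right h (by linarith)
    have h5 : q0 * B ≤ q0 := by nlinarith
    have h6 : B * (f' x + k * f x) ≤ q0 := by nlinarith
    linarith
  set X := x0 + (f x0 + 1) / (-q0) with hX
  have hf0 := hpos x0 le_rfl
  have hXx : x0 ≤ X := by
    have : 0 ≤ (f x0 + 1) / (-q0) := div_nonneg (by linarith) (by linarith)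
    linarith
  have h := hanti (Set.self_mem_Ici) hXx hXx
  have h7 : q0 * (X - x0) = -(f x0 + 1) := by
    have hne : q0 ≠ 0 := hneg.ne
    rw [hX, add_sub_cancel_left, div_neg, mul_neg, mul_div_cancel₀ _ hne]
  simp only [h7, sub_self, mul_zero, Real.exp_zero, one_mul, sub_zero] at h
  have := mul_nonneg (Real.exp_pos (k * (X - x0))).le (hpos X hXx)
  linarith

lemma aux_v (f f' f'' : ℝ → ℝ) (k : ℝ) (hk : 0 < k)
    (hpos : ∀ x, 0 ≤ f x)
    (hf : ∀ x, HasDerivAt f (f' x) x)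
    (hf' : ∀ x, HasDerivAt f' (f'' x) x)
    (hle : ∀ x, f'' x ≤ k ^ 2 * f x) (x : ℝ) : |f' x| ≤ k * f x := by
  have h1 := aux_log f f' f'' k x hk (fun y _ => hpos y) (fun y _ => hf y)
    (fun y _ => hf' y) (fun y _ => hle y)
  have h2 := aux_log (fun y => f (-y)) (fun y => -f' (-y)) (fun y => f'' (-y)) k (-x) hk
    (fun y _ => hpos _)
    (fun y _ => by
      have := (hf (-y)).comp y (hasDerivAt_neg y)
      simpa [Function.comp_def] using this)
    (fun y _ => by
      have h := (hf' (-y)).comp y (hasDerivAt_neg y)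
      have h2 := h.neg
      rw [mul_neg_one, neg_neg] at h2
      exact h2)
    (fun y _ => hle _)
  simp only [neg_neg] at h2
  rw [abs_le]
  constructor <;> linarith

set_option maxHeartbeats 2000000 in
/-- The comparison estimate. -/
lemma aux_comp (χ a b lam mu x1 η L M σ : ℝ)
    (hχ : 0 < χ) (ha : 0 < a) (hlam : 0 < lam)
    (hb2 : χ * mu ≤ b)
    (u0 u0' u0'' : ℝ → ℝ) (hu0pos : ∀ x, 0 < u0 x)
    (hd1 : ∀ x, x1 ≤ x → HasDerivAt u0 (u0' x) x)
    (hd2 : ∀ x, x1 ≤ x → HasDerivAt u0' (u0'' x) x)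
    (hu0' : ∀ x, x1 ≤ x → u0' x ≤ 0)
    (hu0'' : ∀ x, x1 ≤ x → u0'' x ≤ η ^ 2 * u0 x)
    (hη : 0 < η) (hησ : η ^ 2 < σ - a) (hηl : η ≤ Real.sqrt lam)
    (hM : 1 ≤ M) (hML : L ≤ M * u0 x1) (hmu : 0 < mu)
    (u ux uxx ut v vx vxx : ℝ → ℝ → ℝ)
    (hsol : IsClassicalSolution χ a b lam mu u0 u ux uxx ut v vx vxx)
    (hL : ∀ x t, 0 ≤ t → u x t ≤ L) :
    ∀ x t, x1 ≤ x → 0 ≤ t → u x t ≤ M * Real.exp (σ * t) * u0 x := by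
  obtain ⟨hinit, hu, hv, hcont, -, hux, huxx, hut, hvx, hvxx, heq, hell⟩ := hsol
  have hσ : 0 < σ := by nlinarith [sq_nonneg η]
  have hL0 : 0 ≤ L := (hu 0 0 le_rfl).trans (hL 0 0 le_rfl)
  have hκ : 0 < Real.sqrt lam := Real.sqrt_pos.2 hlam
  have hκ2 : Real.sqrt lam ^ 2 = lam := Real.sq_sqrt hlam.le
  have hlow : ∀ x, x1 ≤ x → 0 ≤ u0' x + η * u0 x := fun x hx =>
    aux_log u0 u0' u0'' η x hη (fun y _ => (hu0pos y).le) (fun y hy => hd1 y (hx.trans hy))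
      (fun y hy => hd2 y (hx.trans hy)) (fun y hy => hu0'' y (hx.trans hy))
  have key : ∀ δ, 0 < δ → ∀ x t, x1 ≤ x → 0 ≤ t →
      Real.exp (-σ * t) * u x t ≤ M * u0 x + δ * Real.exp (η * x) := by
    intro δ hδ x t hx ht
    by_contra hcon
    push Not at hcon
    obtain ⟨R, hR1, hR2⟩ : ∃ R, x < R ∧ L ≤ δ * Real.exp (η * R) := by
      have h1 : Filter.Tendsto (fun R => δ * Real.exp (η * R)) Filter.atTop Filter.atTop :=
        (Real.tendsto_exp_atTop.comp (Filter.tendsto_id.const_mul_atTop hη)).const_mul_atTop hδ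
      exact ((Filter.eventually_gt_atTop x).and (h1.eventually_ge_atTop L)).exists
    set K : Set (ℝ × ℝ) := Set.Icc x1 R ×ˢ Set.Icc 0 t with hK
    have hKc : IsCompact K := isCompact_Icc.prod isCompact_Icc
    have hxt : (x, t) ∈ K := ⟨⟨hx, hR1.le⟩, ⟨ht, le_rfl⟩⟩
    have hGc : ContinuousOn (fun p : ℝ × ℝ => Real.exp (-σ * p.2) * u p.1 p.2
        - (M * u0 p.1 + δ * Real.exp (η * p.1))) K := by
      have c1 : ContinuousOn (fun p : ℝ × ℝ => u p.1 p.2) K :=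
        hcont.mono (fun p hp => ⟨Set.mem_univ _, hp.2.1⟩)
      have c2 : ContinuousOn (fun p : ℝ × ℝ => u0 p.1) K := by
        have : ContinuousOn u0 (Set.Icc x1 R) := fun y hy =>
          (hd1 y hy.1).continuousAt.continuousWithinAt
        exact this.comp continuousOn_fst (fun p hp => hp.1)
      have c3 : ContinuousOn (fun p : ℝ × ℝ => Real.exp (-σ * p.2)) K :=
        Continuous.continuousOn (by fun_prop)
      have c4 : ContinuousOn (fun p : ℝ × ℝ => δ * Real.exp (η * p.1)) K :=
        Continuous.continuousOn (by fun_prop)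
      exact (c3.mul c1).sub ((continuousOn_const.mul c2).add c4)
    obtain ⟨⟨y, s⟩, hys, hmax⟩ := hKc.exists_isMaxOn ⟨_, hxt⟩ hGc
    have hG0 : 0 < Real.exp (-σ * s) * u y s - (M * u0 y + δ * Real.exp (η * y)) := by
      have := hmax hxt
      simp only [Set.mem_ofPred_eq] at this
      linarith
    have hy1 : x1 ≤ y := hys.1.1
    have hy2 : y ≤ R := hys.1.2
    have hs1 : 0 ≤ s := hys.2.1
    have hs2 : s ≤ t := hys.2.2
    have hMu : ∀ z, 0 < M * u0 z := fun z => mul_pos (by linarith) (hu0pos z)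
    have hde : ∀ z, 0 < δ * Real.exp (η * z) := fun z => mul_pos hδ (Real.exp_pos _)
    have hUL : Real.exp (-σ * s) * u y s ≤ L := by
      have h1 : Real.exp (-σ * s) ≤ 1 := Real.exp_le_one_iff.2 (by nlinarith)
      have h2 := hu y s hs1
      have h3 := hL y s hs1
      have := mul_le_mul_of_nonneg_right h1 h2
      linarith
    have hys1 : x1 < y := by
      rcases hy1.lt_or_eq with h | h
      · exact h
      · subst h
        linarith [hde x1]
    have hysR : y < R := by
      rcases hy2.lt_or_eq with h | h
      · exact h
      · subst h
        linarith [hMu y]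
    have hs0 : 0 < s := by
      rcases hs1.lt_or_eq with h | h
      · exact h
      · subst h
        simp only [mul_zero, Real.exp_zero, one_mul, hinit] at hG0
        nlinarith [hde y, hu0pos y]
    -- time derivative
    have hE : HasDerivAt (fun r => Real.exp (-σ * r)) (Real.exp (-σ * s) * -σ) s := by
      simpa using ((hasDerivAt_id s).const_mul (-σ)).exp
    have ht1 := aux_tder (fun r => Real.exp (-σ * r) * u y r) _ s hs0
      (hE.mul (hut y s hs0)) (by
        intro r hr1 hr2
        have : (y, r) ∈ K := ⟨hys.1, hr1, hr2.trans hs2⟩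
        have := hmax this
        simp only [Set.mem_ofPred_eq] at this
        linarith)
    have hEx : ∀ z, HasDerivAt (fun r => Real.exp (η * r)) (Real.exp (η * z) * η) z := by
      intro z
      simpa using ((hasDerivAt_id z).const_mul η).exp
    obtain ⟨hx1, hx2⟩ := aux_xder
      (fun z => Real.exp (-σ * s) * u z s - (M * u0 z + δ * Real.exp (η * z)))
      (fun z => Real.exp (-σ * s) * ux z s - (M * u0' z + δ * (Real.exp (η * z) * η)))
      (Real.exp (-σ * s) * uxx y s - (M * u0'' y + δ * (Real.exp (η * y) * η * η)))
      y x1 R hys1 hysR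
      (fun z hz => ((hux z s hs0).const_mul _).sub
        (((hd1 z hz).const_mul M).add ((hEx z).const_mul δ)))
      (((huxx y s hs0).const_mul _).sub
        (((hd2 y hy1).const_mul M).add (((hEx y).mul_const η).const_mul δ)))
      (by
        intro z hz1 hz2
        have : (z, s) ∈ K := ⟨⟨hz1, hz2⟩, hys.2⟩
        exact hmax this)
    have hvb := aux_v (fun z => v z s) (fun z => vx z s) (fun z => vxx z s) (Real.sqrt lam) hκ
      (fun z => hv z s hs1) (fun z => hvx z s hs0) (fun z => hvxx z s hs0)
      (fun z => by
        have h1 := hell z s hs0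
        have h2 := mul_nonneg hmu.le (hu z s hs1)
        simp only [hκ2]
        linarith) y
    have hpde := heq y s hs0
    have hellp := hell y s hs0
    have hv0 := hv y s hs1
    have hu0s := hu y s hs1
    have hMy := hMu y
    have hdy := hde y
    have hlowy := hlow y hy1
    have hupy := hu0' y hy1
    have hsecy := hu0'' y hy1
    have hEp : 0 < Real.exp (-σ * s) := Real.exp_pos _
    set E := Real.exp (-σ * s)
    set F := Real.exp (η * y)
    set κ := Real.sqrt lam
    set B := M * u0 y + δ * F with hB
    set B1 := M * u0' y + δ * (F * η) with hB1
    set B2 := M * u0'' y + δ * (F * η * η) with hB2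
    set V := v y s
    set U := E * u y s with hU
    have hM0 : 0 < M := by linarith
    have b1 : |B1| ≤ η * B := by
      rw [abs_le]
      have := mul_nonneg hM0.le hlowy
      have := mul_nonneg hη.le hdy.le
      have := mul_nonneg hη.le hMy.le
      have : M * u0' y ≤ 0 := mul_nonpos_of_nonneg_of_nonpos hM0.le hupy
      constructor <;> nlinarith
    have b2 : B2 ≤ η ^ 2 * B := by
      have := mul_le_mul_of_nonneg_left hsecy hM0.le
      rw [hB2, hB]
      nlinarith
    have hBU : B ≤ U := by linarith
    have hB0 : 0 < B := by linarith
    have hU0 : 0 < U := by linarith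
    have hdrift : -(χ * (B1 * vx y s)) ≤ χ * lam * V * U := by
      have h1 : |B1| * |vx y s| ≤ (η * B) * (κ * V) :=
        mul_le_mul b1 hvb (abs_nonneg _) (by positivity)
      rw [← abs_mul] at h1
      have h2 := neg_abs_le (B1 * vx y s)
      have h3 : (η * B) * (κ * V) ≤ (κ * U) * (κ * V) := by
        apply mul_le_mul_of_nonneg_right _ (by positivity)
        exact mul_le_mul hηl hBU hB0.le hκ.le
      have h4 : (κ * U) * (κ * V) = lam * V * U := by rw [← hκ2]; ring
      have h5 : -(B1 * vx y s) ≤ lam * V * U := by linarith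
      have h6 := mul_le_mul_of_nonneg_left h5 hχ.le
      linarith
    have hvxx' : vxx y s = lam * V - mu * u y s := by linarith
    have hUx : E * ux y s = B1 := by linarith
    have hUxx : E * uxx y s ≤ η ^ 2 * U := by
      have := mul_le_mul_of_nonneg_left hBU (sq_nonneg η)
      linarith
    have hquad : 0 ≤ (b - χ * mu) * u y s * U :=
      mul_nonneg (mul_nonneg (by linarith) hu0s) hU0.le
    have hfin : E * -σ * u y s + E * ut y s
        = E * uxx y s - χ * (B1 * vx y s) - χ * lam * V * U - (b - χ * mu) * u y s * U
          + (a - σ) * U := by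
      rw [hpde, hvxx', ← hUx, hU]; ring
    rw [hfin] at ht1
    have : (η ^ 2 + a - σ) * U < 0 := mul_neg_of_neg_of_pos (by linarith) hU0
    linarith
  intro x t hx ht
  have h0 : Real.exp (-σ * t) * u x t ≤ M * u0 x := by
    apply le_of_forall_pos_le_add
    intro e he
    have := key (e / Real.exp (η * x)) (div_pos he (Real.exp_pos _)) x t hx ht
    rwa [div_mul_cancel₀ _ (Real.exp_pos _).ne'] at this
  have hm : Real.exp (σ * t) * Real.exp (-σ * t) = 1 := by
    rw [← Real.exp_add]; simp
  have := mul_le_mul_of_nonneg_left h0 (Real.exp_pos (σ * t)).le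
  calc u x t = Real.exp (σ * t) * (Real.exp (-σ * t) * u x t) := by
        rw [← mul_assoc, hm, one_mul]
    _ ≤ Real.exp (σ * t) * (M * u0 x) := this
    _ = _ := by ring

/-- Lemma 3.1 (upper bound for the level set): assume `b > 2χμ` and `u0` satisfies
(1.2) and (1.10); let `(u, v)` be the classical solution with `u(·,0) = u0`.  For any
`ε > 0` and `γ1 > 0`, if `u0 (ζ t) = γ1 exp (-(a+ε) t)` for all large `t`, then for
any `ω ∈ (0, a/b)` there is `T₁ ≥ 0` with `E_ω(t) ⊆ (-∞, ζ t]` for all `t ≥ T₁`. -/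
theorem stmt9 (χ a b lam mu ξ0 : ℝ)
    (hχ : 0 < χ) (ha : 0 < a) (hb : 0 < b) (hlam : 0 < lam) (hmu : 0 < mu)
    (hb2 : 2 * χ * mu < b)
    (u0 u0' u0'' : ℝ → ℝ) (hu0 : SlowlyDecayingInit u0 u0' u0'' ξ0)
    (u ux uxx ut v vx vxx : ℝ → ℝ → ℝ)
    (hsol : IsClassicalSolution χ a b lam mu u0 u ux uxx ut v vx vxx)
    (ε γ1 : ℝ) (hε : 0 < ε) (hγ1 : 0 < γ1)
    (ζ : ℝ → ℝ)
    (hζ : ∃ T0 : ℝ, ∀ t, T0 ≤ t → u0 (ζ t) = γ1 * Real.exp (-(a + ε) * t)) :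
    ∀ ω : ℝ, 0 < ω → ω < a / b → ∃ T1 : ℝ, 0 ≤ T1 ∧ ∀ t, T1 ≤ t →
      ∀ x : ℝ, u x t = ω → x ≤ ζ t := by
  obtain ⟨hc0, hpos, hlim, hto0, hd1, hd2, -, hmono, hratio⟩ := hu0
  intro ω hω _
  obtain ⟨L, hL⟩ := hsol.2.2.2.2.1
  set η := min (Real.sqrt lam) (min 1 (ε / 4)) with hηdef
  have hη : 0 < η := lt_min (Real.sqrt_pos.2 hlam) (lt_min one_pos (by linarith))
  have hη1 : η ≤ 1 := (min_le_right _ _).trans (min_le_left _ _)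
  have hη2 : η ≤ ε / 4 := (min_le_right _ _).trans (min_le_right _ _)
  obtain ⟨x1, hx1, hx1ξ⟩ : ∃ x1, (∀ x, x1 ≤ x → u0'' x / u0 x < η ^ 2) ∧ ξ0 ≤ x1 := by
    have h1 := hratio.eventually (gt_mem_nhds (show (0 : ℝ) < η ^ 2 by positivity))
    obtain ⟨N, hN⟩ := Filter.eventually_atTop.1 h1
    exact ⟨max N ξ0, fun x hx => hN x ((le_max_left _ _).trans hx), le_max_right _ _⟩
  set M := max 1 (L / u0 x1) with hM
  have hML : L ≤ M * u0 x1 := by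
    rw [← div_le_iff₀ (hpos x1)]; exact le_max_right _ _
  have hM1 : 1 ≤ M := le_max_left _ _
  have hcomp := aux_comp χ a b lam mu x1 η L M (a + ε / 2) hχ ha hlam
    (by nlinarith [mul_pos hχ hmu]) u0 u0' u0'' hpos
    (fun x hx => hd1 x (hx1ξ.trans hx)) (fun x hx => hd2 x (hx1ξ.trans hx))
    (fun x hx => hmono x (hx1ξ.trans hx))
    (fun x hx => ((div_lt_iff₀ (hpos x)).1 (hx1 x hx)).le) hη (by nlinarith) (min_le_left _ _)
    hM1 hML hmu u ux uxx ut v vx vxx hsol hL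
  -- lower bound of `u0` on the left half line
  obtain ⟨c, hc, hcl⟩ : ∃ c, 0 < c ∧ ∀ x, x ≤ x1 → c ≤ u0 x := by
    obtain ⟨c1, hc1, hc1p⟩ : ∃ c1, (∀ᶠ x in Filter.atBot, c1 ≤ u0 x) ∧ 0 < c1 := by
      rw [Filter.liminf_eq] at hlim
      have hne : {a : ℝ | ∀ᶠ n in Filter.atBot, a ≤ u0 n}.Nonempty :=
        ⟨0, Filter.Eventually.of_forall fun x => (hpos x).le⟩
      obtain ⟨c1, h1, h2⟩ := exists_lt_of_lt_csSup hne hlim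
      exact ⟨c1, h1, h2⟩
    obtain ⟨N, hN⟩ := Filter.eventually_atBot.1 hc1
    obtain ⟨z, -, hz⟩ := (isCompact_Icc (a := min N x1) (b := x1)).exists_isMinOn
      ⟨x1, min_le_right _ _, le_rfl⟩ hc0.continuousOn
    refine ⟨min c1 (u0 z), lt_min hc1p (hpos z), fun x hx => ?_⟩
    rcases le_total x (min N x1) with h | h
    · exact (min_le_left _ _).trans (hN x (h.trans (min_le_left _ _)))
    · exact (min_le_right _ _).trans (hz ⟨h, hx⟩)
  have hdecay : ∀ k : ℝ, 0 < k → ∀ A : ℝ,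
      Filter.Tendsto (fun t => A * Real.exp (-k * t)) Filter.atTop (nhds 0) := by
    intro k hk A
    have h1 : Filter.Tendsto (fun t : ℝ => -k * t) Filter.atTop Filter.atBot :=
      Filter.tendsto_id.const_mul_atTop_of_neg (by linarith)
    have := (Real.tendsto_exp_atBot.comp h1).const_mul A
    simpa using this
  obtain ⟨T0, hT0⟩ := hζ
  have e1 := (hdecay (a + ε) (by linarith) γ1).eventually (gt_mem_nhds hc)
  have e2 := (hdecay (ε / 2) (by linarith) (M * γ1)).eventually (gt_mem_nhds hω)
  obtain ⟨T, hT⟩ := Filter.eventually_atTop.1 (e1.and e2)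
  refine ⟨max 0 (max T0 T), le_max_left _ _, fun t ht x hxω => ?_⟩
  have ht0 : 0 ≤ t := (le_max_left _ _).trans ht
  have htT0 : T0 ≤ t := (le_max_left _ _).trans ((le_max_right _ _).trans ht)
  have htT : T ≤ t := (le_max_right _ _).trans ((le_max_right _ _).trans ht)
  obtain ⟨h1, h2⟩ := hT t htT
  have hz := hT0 t htT0
  by_contra hx
  push Not at hx
  have hζ1 : x1 < ζ t := by
    by_contra h
    push Not at h
    have := hcl _ h
    linarith
  have hmon : u0 x ≤ u0 (ζ t) := by
    have : AntitoneOn u0 (Set.Ici x1) :=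
      antitoneOn_of_hasDerivWithinAt_nonpos (convex_Ici x1) hc0.continuousOn
        (fun y hy => (hd1 y (hx1ξ.trans (interior_subset hy))).hasDerivWithinAt)
        (fun y hy => hmono y (hx1ξ.trans (interior_subset hy)))
    exact this hζ1.le (hζ1.trans hx).le hx.le
  have hb := hcomp x t (hζ1.trans hx).le ht0
  have hm : Real.exp ((a + ε / 2) * t) * Real.exp (-(a + ε) * t) = Real.exp (-(ε / 2) * t) := by
    rw [← Real.exp_add]; congr 1; ring
  have hE := Real.exp_pos ((a + ε / 2) * t)
  have h3 : M * Real.exp ((a + ε / 2) * t) * u0 x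
      ≤ M * Real.exp ((a + ε / 2) * t) * (γ1 * Real.exp (-(a + ε) * t)) := by
    rw [← hz]
    exact mul_le_mul_of_nonneg_left hmon (by positivity)
  have h4 : M * Real.exp ((a + ε / 2) * t) * (γ1 * Real.exp (-(a + ε) * t))
      = M * γ1 * Real.exp (-(ε / 2) * t) := by rw [← hm]; ring
  linarith
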